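/- Let H be an elementary abelian 2-hypergroup and G a closed subset of H. Then Thick(G) = O^ϑ(G) and |Thick(G)| = |O^ϑ(G)| = 2^{s(G)}. -/

import Mathlib

namespace HyperPaper

/-- A hypergroup: hypermultiplication `hmul`, inversion `star`, identity `e`,
satisfying (H1) associativity, (H2) unique two-sided identity, (H3) exchange conditions. -/
structure Hypergroup (H : Type*) where
  hmul : H → H → Set H
  star : H → H
  e : H
  idl : ∀ p, hmul e p = {p}
  idr : ∀ p, hmul p e = {p}
  e_unique : ∀ e' : H, (∀ p, hmul e' p = {p} ∧ hmul p e' = {p}) → e' = e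
  assoc : ∀ p q r : H, (⋃ x ∈ hmul p q, hmul x r) = ⋃ x ∈ hmul q r, hmul p x
  h3l : ∀ p q r : H, p ∈ hmul q r ↔ q ∈ hmul p (star r)
  h3r : ∀ p q r : H, p ∈ hmul q r ↔ r ∈ hmul (star q) p

variable {H : Type*}

namespace Hypergroup

/-- Product of two subsets: FG = {a : ∃ b ∈ F, c ∈ G, a ∈ bc}. -/
def smul (hg : Hypergroup H) (F G : Set H) : Set H :=
  {a | ∃ b ∈ F, ∃ c ∈ G, a ∈ hg.hmul b c}

/-- Closed subset: nonempty and G*G ⊆ G. -/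
def IsClosed (hg : Hypergroup H) (G : Set H) : Prop :=
  G.Nonempty ∧ hg.smul (hg.star '' G) G ⊆ G

/-- Thin element: p*p = {e}. -/
def IsThin (hg : Hypergroup H) (p : H) : Prop := hg.hmul (hg.star p) p = {hg.e}

/-- Thick element: not thin. -/
def IsThick (hg : Hypergroup H) (p : H) : Prop := ¬ hg.IsThin p

/-- Involution: p ≠ e and {e, p} is closed. -/
def IsInvolution (hg : Hypergroup H) (p : H) : Prop :=
  p ≠ hg.e ∧ hg.IsClosed {hg.e, p}

/-- ⟨G⟩: smallest closed subset containing G. -/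
def gen (hg : Hypergroup H) (G : Set H) : Set H := ⋂₀ {C | hg.IsClosed C ∧ G ⊆ C}

/-- O_ϑ(G): the thin elements of H lying in G. -/
def Othin (hg : Hypergroup H) (G : Set H) : Set H := {p ∈ G | hg.IsThin p}

/-- F is a strongly normal closed subset of G: p*Fp ⊆ F ⊆ G for all p ∈ G. -/
def IsStronglyNormal (hg : Hypergroup H) (F G : Set H) : Prop :=
  hg.IsClosed F ∧ hg.IsClosed G ∧ F ⊆ G ∧
    ∀ p ∈ G, hg.smul (hg.smul {hg.star p} F) {p} ⊆ F

/-- O^ϑ(G): intersection of all strongly normal closed subsets of ⟨G⟩. -/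
def Osup (hg : Hypergroup H) (G : Set H) : Set H :=
  ⋂₀ {F | hg.IsStronglyNormal F (hg.gen G)}

/-- F is a normal closed subset of G. -/
def IsNormal (hg : Hypergroup H) (F G : Set H) : Prop :=
  hg.IsClosed F ∧ hg.IsClosed G ∧ F ⊆ G ∧ ∀ p ∈ G, hg.smul F {p} = hg.smul {p} F

/-- Product of a list of subsets (empty product is {e}). -/
def listProd (hg : Hypergroup H) : List (Set H) → Set H
  | [] => {hg.e}
  | a :: l => hg.smul a (hg.listProd l)

/-- Product r_1 r_2 ⋯ r_n of a family of elements. -/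
def famProd (hg : Hypergroup H) {n : ℕ} (r : Fin n → H) : Set H :=
  hg.listProd ((List.finRange n).map fun i => ({r i} : Set H))

/-- Ĝ_i: the product of the G_j with j ≠ i. -/
def cofactor (hg : Hypergroup H) {n : ℕ} (G : Fin n → Set H) (i : Fin n) : Set H :=
  hg.listProd (((List.finRange n).filter fun j => decide (j ≠ i)).map G)

/-- H is the direct product of the normal closed subsets G_1, …, G_n. -/
def IsDirectProduct (hg : Hypergroup H) {n : ℕ} (G : Fin n → Set H) : Prop :=
  (∀ i, hg.IsNormal (G i) Set.univ) ∧
  (∀ i, hg.smul (G i) (hg.cofactor G i) = Set.univ) ∧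
  (∀ i, G i ∩ hg.cofactor G i = {hg.e})

/-- r : Fin n → H is a decomposition of x with respect to the family G. -/
def IsDecomp (hg : Hypergroup H) {n : ℕ} (G : Fin n → Set H) (x : H) (r : Fin n → H) : Prop :=
  (∀ i, r i ∈ G i) ∧ x ∈ hg.famProd r

/-- The support of x: the elements ≠ e appearing in the decomposition of x. -/
def dsupport (hg : Hypergroup H) {n : ℕ} (G : Fin n → Set H) (x : H) : Set H :=
  {y | y ≠ hg.e ∧ ∃ r, hg.IsDecomp G x r ∧ y ∈ Set.range r}

/-- The cover of x: the product r_1r_2⋯r_n for the decomposition of x. -/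
def dcover (hg : Hypergroup H) {n : ℕ} (G : Fin n → Set H) (x : H) : Set H :=
  {y | ∃ r, hg.IsDecomp G x r ∧ y ∈ hg.famProd r}

/-- x is constrained: its cover equals {x}. -/
def IsConstrained (hg : Hypergroup H) {n : ℕ} (G : Fin n → Set H) (x : H) : Prop :=
  hg.dcover G x = {x}

/-- r_2(G): the largest 2-rank of a thin closed subset of H contained in G
(equivalently, the largest k such that G contains a thin symmetric closed subset
of 2^k elements, which corresponds to an elementary abelian 2-group of 2-rank k). -/
noncomputable def rank2 (hg : Hypergroup H) (G : Set H) : ℕ :=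
  sSup {k | ∃ U : Set H, hg.IsClosed U ∧ U ⊆ G ∧ (∀ u ∈ U, hg.IsThin u) ∧
    (∀ u ∈ U, hg.star u = u) ∧ U.ncard = 2 ^ k}

/-- F is a minimal generating subset of G. -/
def IsMinGen (hg : Hypergroup H) (G F : Set H) : Prop :=
  F ⊆ G ∧ hg.gen F = G ∧ ∀ p ∈ F, hg.gen (F \ {p}) ≠ G

/-- The dimension of G: the smallest cardinality of a minimal generating subset. -/
noncomputable def dimension (hg : Hypergroup H) (G : Set H) : ℕ :=
  sInf {k | ∃ F : Set H, hg.IsMinGen G F ∧ F.Finite ∧ F.ncard = k}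

/-- [F, G] = ⟨{a : ∃ b ∈ F, c ∈ G, a ∈ b*c*bc}⟩. -/
def commSet (hg : Hypergroup H) (F G : Set H) : Set H :=
  hg.gen {a | ∃ b ∈ F, ∃ c ∈ G,
    a ∈ hg.smul (hg.smul (hg.smul {hg.star b} {hg.star c}) {b}) {c}}

/-- derived G k = G^{(k+1)}: G^{(1)} = G, G^{(r)} = [G^{(r-1)}, G]. -/
def derived (hg : Hypergroup H) (G : Set H) : ℕ → Set H
  | 0 => G
  | k + 1 => hg.commSet (hg.derived G k) G

/-- G is nilpotent: G^{(r)} = {e} for some r. -/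
def IsNilpotent (hg : Hypergroup H) (G : Set H) : Prop :=
  ∃ k : ℕ, hg.derived G k = {hg.e}

/-- G is a residually thin closed subset: there is a chain {e} = F_1, …, F_n = G of
pairwise distinct closed subsets, each strongly normal in the next. -/
def IsResiduallyThin (hg : Hypergroup H) (G : Set H) : Prop :=
  ∃ (m : ℕ) (F : Fin (m + 1) → Set H), Function.Injective F ∧
    F 0 = {hg.e} ∧ F (Fin.last m) = G ∧
    ∀ i : Fin m, hg.IsStronglyNormal (F i.castSucc) (F i.succ)

/-- x^k as a subset: x^0 = {e}, x^{k+1} = x^k · x. -/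
def spow (hg : Hypergroup H) (x : H) : ℕ → Set H
  | 0 => {hg.e}
  | k + 1 => hg.smul (hg.spow x k) {x}

/-- F is a maximal closed subset of G. -/
def IsMaximalClosed (hg : Hypergroup H) (F G : Set H) : Prop :=
  hg.IsClosed F ∧ hg.IsClosed G ∧ F ⊆ G ∧ F ≠ G ∧
    ∀ E : Set H, hg.IsClosed E → F ⊆ E → E ⊆ G → E = F ∨ E = G

/-- The Frattini closed subset of G: the intersection (inside G) of all maximal
closed subsets of G. -/
def frattini (hg : Hypergroup H) (G : Set H) : Set H :=
  G ∩ ⋂₀ {F | hg.IsMaximalClosed F G}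

/-- α is an isomorphism from the closed subset F to the closed subset G. -/
def IsIso (hg : Hypergroup H) (F G : Set H) (α : H → H) : Prop :=
  Set.BijOn α F G ∧ α hg.e = hg.e ∧
    ∀ p ∈ F, ∀ q ∈ F, α '' hg.hmul p q = hg.hmul (α p) (α q)

/-- F ≃ G: there is an isomorphism from F to G. -/
def Isomorphic (hg : Hypergroup H) (F G : Set H) : Prop := ∃ α : H → H, hg.IsIso F G α

/-- Aut(G): the automorphism group of G, realized as the subgroup of permutations of G
that fix e and preserve the hypermultiplication. -/
def autGroup (hg : Hypergroup H) (G : Set H) : Subgroup (Equiv.Perm G) where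
  carrier := {σ | (∀ x : G, (x : H) = hg.e → ((σ x : H)) = hg.e) ∧
    ∀ p q x : G, (x : H) ∈ hg.hmul p q ↔ ((σ x : H)) ∈ hg.hmul (σ p) (σ q)}
  one_mem' := by
    constructor
    · intro x hx; simpa using hx
    · intro p q x; simp
  mul_mem' := by
    rintro σ τ ⟨he1, hm1⟩ ⟨he2, hm2⟩
    refine ⟨fun x hx => ?_, fun p q x => ?_⟩
    · simpa using he1 _ (he2 x hx)
    · simpa using (hm2 p q x).trans (hm1 (τ p) (τ q) (τ x))
  inv_mem' := by
    rintro σ ⟨he, hm⟩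
    refine ⟨fun x hx => ?_, fun p q x => ?_⟩
    · have h2 : σ x = x := Subtype.ext ((he x hx).trans hx.symm)
      have h3 : σ⁻¹ x = x := by
        conv_lhs => rw [← h2]
        simp
      rw [h3]; exact hx
    · have h := hm (σ⁻¹ p) (σ⁻¹ q) (σ⁻¹ x)
      simpa using h.symm

end Hypergroup

/-- An elementary abelian 2-hypergroup: a hypergroup that is the constrained direct
product of the closed subsets ⟨q_1⟩, …, ⟨q_n⟩ generated by involutions q_1, …, q_n. -/
structure EA2Data (H : Type*) where
  hg : Hypergroup H
  n : ℕ
  q : Fin n → H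
  invol : ∀ i, hg.IsInvolution (q i)
  dp : hg.IsDirectProduct fun i => hg.gen {q i}
  constrained : ∀ x : H, hg.IsConstrained (fun i => hg.gen {q i}) x

namespace EA2Data

/-- The family ⟨q_1⟩, …, ⟨q_n⟩. -/
def fam (E : EA2Data H) : Fin E.n → Set H := fun i => E.hg.gen {E.q i}

/-- The support of x. -/
def support (E : EA2Data H) (x : H) : Set H := E.hg.dsupport E.fam x

/-- Thick(F): externally thick elements of H lying in F. -/
def ThickIn (E : EA2Data H) (F : Set H) : Set H :=
  {x ∈ F | x = E.hg.e ∨ ∀ y ∈ E.support x, E.hg.IsThick y}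

/-- Thin(F): externally thin elements of H lying in F. -/
def ThinIn (E : EA2Data H) (F : Set H) : Set H :=
  {x ∈ F | x = E.hg.e ∨ ∀ y ∈ E.support x, E.hg.IsThin y}

/-- The (unique) pair (x⁺, x⁻) with x⁺ ∈ Thick(H), x⁻ ∈ Thin(H), x⁺x⁻ = {x}. -/
noncomputable def pm (E : EA2Data H) (x : H) : H × H :=
  @Classical.epsilon (H × H) ⟨(E.hg.e, E.hg.e)⟩ fun z =>
    z.1 ∈ E.ThickIn Set.univ ∧ z.2 ∈ E.ThinIn Set.univ ∧ E.hg.hmul z.1 z.2 = {x}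

/-- x⁺. -/
noncomputable def plus (E : EA2Data H) (x : H) : H := (E.pm x).1

/-- x⁻. -/
noncomputable def minus (E : EA2Data H) (x : H) : H := (E.pm x).2

/-- s(x): the number of thick elements of H in the support of x. -/
noncomputable def sElem (E : EA2Data H) (x : H) : ℕ :=
  {y ∈ E.support x | E.hg.IsThick y}.ncard

/-- s(G) = max {s(a) : a ∈ G}. -/
noncomputable def sSet (E : EA2Data H) (G : Set H) : ℕ :=
  sSup {k | ∃ a ∈ G, E.sElem a = k}

/-- x ⪯ y: the support of x is contained in the support of y. -/
def ple (E : EA2Data H) (x y : H) : Prop := E.support x ⊆ E.support y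

/-- p♯: the number of thick elements among q_1, …, q_n. -/
noncomputable def psharp (E : EA2Data H) : ℕ := {i : Fin E.n | E.hg.IsThick (E.q i)}.ncard

end EA2Data

/-- The Gaussian binomial coefficient C(n, k)_2 with base 2, via the
q-Pascal recurrence C(n, k)_2 = C(n-1, k-1)_2 + 2^k · C(n-1, k)_2. -/
def gaussBinom2 : ℕ → ℕ → ℕ
  | _, 0 => 1
  | 0, _ + 1 => 0
  | n + 1, k + 1 => gaussBinom2 n k + 2 ^ (k + 1) * gaussBinom2 n (k + 1)

end HyperPaper

namespace HyperPaper

namespace Hypergroup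

theorem mem_smul_left {hg : Hypergroup H} {F : Set H} {q x : H} :
    x ∈ hg.smul {q} F ↔ ∃ c ∈ F, x ∈ hg.hmul q c := by
  simp [smul]

theorem smul_singleton (hg : Hypergroup H) (p q : H) : hg.smul {p} {q} = hg.hmul p q := by
  ext; simp [smul]

theorem smul_assoc (hg : Hypergroup H) (F K L : Set H) :
    hg.smul (hg.smul F K) L = hg.smul F (hg.smul K L) := by
  have key (p q r a : H) :
      (∃ x ∈ hg.hmul p q, a ∈ hg.hmul x r) ↔ ∃ x ∈ hg.hmul q r, a ∈ hg.hmul p x := by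
    simpa using Set.ext_iff.1 (hg.assoc p q r) a
  ext a
  constructor
  · rintro ⟨x, ⟨p, hp, q, hq, hx⟩, r, hr, ha⟩
    obtain ⟨y, hy, hay⟩ := (key p q r a).1 ⟨x, hx, ha⟩
    exact ⟨p, hp, y, ⟨q, hq, r, hr, hy⟩, hay⟩
  · rintro ⟨p, hp, x, ⟨q, hq, r, hr, hx⟩, ha⟩
    obtain ⟨y, hy, hay⟩ := (key p q r a).2 ⟨x, hx, ha⟩
    exact ⟨y, ⟨p, hp, q, hq, hy⟩, r, hr, hay⟩

/-- The subsets of a hypergroup form a monoid under the subset product. -/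
abbrev setMonoid (hg : Hypergroup H) : Monoid (Set H) where
  mul := hg.smul
  one := {hg.e}
  mul_assoc := hg.smul_assoc
  one_mul F := by
    change hg.smul {hg.e} F = F
    ext; simp [smul, hg.idl]
  mul_one F := by
    change hg.smul F {hg.e} = F
    ext; simp [smul, hg.idr]

theorem listProd_eq_prod (hg : Hypergroup H) (l : List (Set H)) :
    hg.listProd l = letI := hg.setMonoid; l.prod := by
  let _ := hg.setMonoid
  induction l with
  | nil => rfl
  | cons a l ih => rw [List.prod_cons, ← ih]; rfl

theorem e_mem_star_mul (hg : Hypergroup H) (p : H) : hg.e ∈ hg.hmul (hg.star p) p :=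
  (hg.h3r p p hg.e).1 (by simp [hg.idr])

theorem e_mem_mul_star (hg : Hypergroup H) (p : H) : hg.e ∈ hg.hmul p (hg.star p) :=
  (hg.h3l p hg.e p).1 (by simp [hg.idl])

theorem hmul_nonempty (hg : Hypergroup H) (p q : H) : (hg.hmul p q).Nonempty := by
  have h : p ∈ hg.smul (hg.smul {p} {q}) {hg.star q} := by
    rw [smul_assoc, mem_smul_left]
    refine ⟨hg.e, ?_, by simp [hg.idr]⟩
    rw [smul_singleton]
    exact hg.e_mem_mul_star q
  obtain ⟨x, hx, -⟩ := h
  exact ⟨x, by rwa [smul_singleton] at hx⟩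

theorem smul_nonempty {hg : Hypergroup H} {F K : Set H} (hF : F.Nonempty) (hK : K.Nonempty) :
    (hg.smul F K).Nonempty := by
  obtain ⟨p, hp⟩ := hF
  obtain ⟨q, hq⟩ := hK
  obtain ⟨x, hx⟩ := hg.hmul_nonempty p q
  exact ⟨x, p, hp, q, hq, hx⟩

theorem star_eq_of_e_mem {hg : Hypergroup H} {p : H} (h : hg.e ∈ hg.hmul p p) :
    hg.star p = p := by
  have := (hg.h3l hg.e p p).1 h
  rw [hg.idl] at this
  exact this.symm

theorem IsClosed.e_mem {hg : Hypergroup H} {C : Set H} (hC : hg.IsClosed C) : hg.e ∈ C := by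
  obtain ⟨x, hx⟩ := hC.1
  exact hC.2 ⟨_, ⟨x, hx, rfl⟩, x, hx, hg.e_mem_star_mul x⟩

theorem IsClosed.gen_eq {hg : Hypergroup H} {C : Set H} (hC : hg.IsClosed C) : hg.gen C = C :=
  Set.Subset.antisymm (Set.sInter_subset_of_mem ⟨hC, subset_rfl⟩)
    (Set.subset_sInter fun _ h => h.2)

namespace IsInvolution

variable {hg : Hypergroup H} {q : H}

theorem gen_eq (hq : hg.IsInvolution q) : hg.gen {q} = {hg.e, q} := by
  refine Set.Subset.antisymm (Set.sInter_subset_of_mem ⟨hq.2, by simp⟩)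
    (Set.subset_sInter fun C hC => ?_)
  exact Set.insert_subset hC.1.e_mem hC.2

theorem star_eq (hq : hg.IsInvolution q) : hg.star q = q := by
  have h : hg.star q ∈ ({hg.e, q} : Set H) :=
    hq.2.2 ⟨hg.star q, ⟨q, by simp, rfl⟩, hg.e, by simp, by simp [hg.idr]⟩
  rcases h with h | h
  · have := hg.e_mem_star_mul q
    rw [h, hg.idl] at this
    exact absurd this.symm hq.1
  · exact h

theorem e_mem_sq (hq : hg.IsInvolution q) : hg.e ∈ hg.hmul q q := by
  simpa [hq.star_eq] using hg.e_mem_star_mul q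

theorem sq_subset (hq : hg.IsInvolution q) : hg.hmul q q ⊆ {hg.e, q} := fun x hx =>
  hq.2.2 ⟨hg.star q, ⟨q, by simp, rfl⟩, q, by simp, by rwa [hq.star_eq]⟩

theorem isThin_iff (hq : hg.IsInvolution q) : hg.IsThin q ↔ hg.hmul q q = {hg.e} := by
  rw [IsThin, hq.star_eq]

theorem sq_of_isThick (hq : hg.IsInvolution q) (h : hg.IsThick q) :
    hg.hmul q q = {hg.e, q} := by
  refine Set.Subset.antisymm hq.sq_subset (Set.insert_subset hq.e_mem_sq ?_)
  rw [Set.singleton_subset_iff]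
  by_contra hn
  refine h (hq.isThin_iff.2 (Set.Subset.antisymm (fun x hx => ?_) (by simpa using hq.e_mem_sq)))
  rcases hq.sq_subset hx with rfl | rfl
  · rfl
  · exact absurd hx hn

theorem hmul_subset_of_normal {p : H} (hq : hg.IsInvolution q) (hp : hg.IsInvolution p)
    (hpq : p ≠ q) (hn : hg.IsNormal (hg.gen {p}) Set.univ) :
    hg.hmul p q ⊆ hg.hmul q p := by
  intro x hx
  have hmem : x ∈ hg.smul {q} {hg.e, p} := by
    rw [← hp.gen_eq, ← hn.2.2.2 q (Set.mem_univ q), hp.gen_eq]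
    exact ⟨p, by simp, q, rfl, hx⟩
  obtain ⟨c, rfl | rfl, hc⟩ := mem_smul_left.1 hmem
  · rw [hg.idr, Set.mem_singleton_iff] at hc
    subst hc
    have h := (hg.h3l x p x).1 hx
    rw [hq.star_eq] at h
    rcases hq.sq_subset h with h | h
    · exact absurd h hp.1
    · exact absurd h hpq
  · exact hc

theorem hmul_subset_of_normal' {p : H} (hq : hg.IsInvolution q) (hp : hg.IsInvolution p)
    (hpq : p ≠ q) (hn : hg.IsNormal (hg.gen {p}) Set.univ) :
    hg.hmul q p ⊆ hg.hmul p q := by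
  intro x hx
  have hmem : x ∈ hg.smul {hg.e, p} {q} := by
    rw [← hp.gen_eq, hn.2.2.2 q (Set.mem_univ q), hp.gen_eq]
    exact ⟨q, rfl, p, by simp, hx⟩
  obtain ⟨c, rfl | rfl, b, rfl, hc⟩ := hmem
  · rw [hg.idl, Set.mem_singleton_iff] at hc
    subst hc
    have h := (hg.h3r x x p).1 hx
    rw [hq.star_eq] at h
    rcases hq.sq_subset h with h | h
    · exact absurd h hp.1
    · exact absurd h hpq
  · exact hc

end IsInvolution

end Hypergroup

namespace EA2Data

open Hypergroup

theorem hmul_q_comm (E : EA2Data H) (i j : Fin E.n) :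
    E.hg.hmul (E.q i) (E.q j) = E.hg.hmul (E.q j) (E.q i) := by
  by_cases h : E.q i = E.q j
  · rw [h]
  · exact Set.Subset.antisymm ((E.invol j).hmul_subset_of_normal (E.invol i) h (E.dp.1 i))
      ((E.invol j).hmul_subset_of_normal' (E.invol i) h (E.dp.1 i))

theorem mem_gen_q {E : EA2Data H} {i : Fin E.n} {x : H} :
    x ∈ E.hg.gen {E.q i} ↔ x = E.hg.e ∨ x = E.q i := by
  rw [(E.invol i).gen_eq]; rfl

theorem famProd_eq_singleton {E : EA2Data H} {r : Fin E.n → H} {x : H}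
    (hr : ∀ i, r i ∈ E.hg.gen {E.q i}) (hx : x ∈ E.hg.famProd r) : E.hg.famProd r = {x} := by
  refine Set.Subset.antisymm (fun y hy => ?_) (by simpa using hx)
  rw [← show E.hg.dcover (fun i => E.hg.gen {E.q i}) x = {x} from E.constrained x]
  exact ⟨r, ⟨hr, hx⟩, hy⟩

theorem exists_decomp (E : EA2Data H) (x : H) :
    ∃ r : Fin E.n → H, (∀ i, r i ∈ E.hg.gen {E.q i}) ∧ E.hg.famProd r = {x} := by
  have h : x ∈ E.hg.dcover (fun i => E.hg.gen {E.q i}) x := by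
    rw [show E.hg.dcover (fun i => E.hg.gen {E.q i}) x = {x} from E.constrained x]; rfl
  obtain ⟨r, ⟨hr, hx⟩, -⟩ := h
  exact ⟨r, hr, famProd_eq_singleton hr hx⟩

theorem smul_comm (E : EA2Data H) (F K : Set H) : E.hg.smul F K = E.hg.smul K F := by
  let _ := E.hg.setMonoid
  have key (x y : H) : E.hg.hmul x y = E.hg.hmul y x := by
    obtain ⟨r, hr, hx⟩ := E.exists_decomp x
    obtain ⟨t, ht, hy⟩ := E.exists_decomp y
    have : Commute ({x} : Set H) {y} := by
      rw [← hx, ← hy, famProd, famProd, listProd_eq_prod, listProd_eq_prod]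
      refine Commute.list_prod_left _ _ fun a ha => Commute.list_prod_right _ _ fun b hb => ?_
      simp only [List.mem_map, List.mem_finRange, true_and] at ha hb
      obtain ⟨i, rfl⟩ := ha
      obtain ⟨j, rfl⟩ := hb
      rcases mem_gen_q.1 (hr i) with h | h <;> rcases mem_gen_q.1 (ht j) with h' | h' <;>
        rw [h, h']
      · exact Commute.one_left _
      · exact Commute.one_right _
      · change E.hg.smul _ _ = E.hg.smul _ _
        rw [smul_singleton, smul_singleton, hmul_q_comm]
    simpa only [smul_singleton] using show E.hg.smul {x} {y} = E.hg.smul {y} {x} from this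
  ext a
  constructor <;>
  · rintro ⟨b, hb, c, hc, h⟩
    exact ⟨c, hc, b, hb, key b c ▸ h⟩

/-- The subsets of an elementary abelian 2-hypergroup form a commutative monoid. -/
abbrev setCommMonoid (E : EA2Data H) : CommMonoid (Set H) where
  __ := E.hg.setMonoid
  mul_comm := E.smul_comm

/-- The product of the involutions `q i` with `i ∈ A`. -/
noncomputable def prodSet (E : EA2Data H) (A : Finset (Fin E.n)) : Set H :=
  letI := E.setCommMonoid
  ∏ i ∈ A, {E.q i}

theorem prodSet_empty (E : EA2Data H) : E.prodSet ∅ = {E.hg.e} := by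
  let _ := E.setCommMonoid
  exact Finset.prod_empty

theorem prodSet_insert (E : EA2Data H) {A : Finset (Fin E.n)} {i : Fin E.n} (hi : i ∉ A) :
    E.prodSet (insert i A) = E.hg.smul {E.q i} (E.prodSet A) := by
  let _ := E.setCommMonoid
  exact Finset.prod_insert hi

theorem prodSet_union (E : EA2Data H) {A B : Finset (Fin E.n)} (h : Disjoint A B) :
    E.prodSet (A ∪ B) = E.hg.smul (E.prodSet A) (E.prodSet B) := by
  let _ := E.setCommMonoid
  exact Finset.prod_union h

theorem famProd_eq_prodSet (E : EA2Data H) (A : Finset (Fin E.n)) {r : Fin E.n → H}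
    (h1 : ∀ i ∈ A, r i = E.q i) (h2 : ∀ i ∉ A, r i = E.hg.e) :
    E.hg.famProd r = E.prodSet A := by
  let _ := E.setCommMonoid
  rw [famProd, listProd_eq_prod]
  calc ((List.finRange E.n).map fun i => ({r i} : Set H)).prod
      = ∏ i ∈ (List.finRange E.n).toFinset, ({r i} : Set H) :=
        (List.prod_toFinset _ (List.nodup_finRange _)).symm
    _ = ∏ i ∈ A, ({r i} : Set H) :=
        (Finset.prod_subset (fun i _ => by simp) fun i _ hi => by rw [h2 i hi]; rfl).symm
    _ = ∏ i ∈ A, ({E.q i} : Set H) := Finset.prod_congr rfl fun i hi => by rw [h1 i hi]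

theorem prodSet_nonempty (E : EA2Data H) (A : Finset (Fin E.n)) : (E.prodSet A).Nonempty := by
  induction A using Finset.induction_on with
  | empty => rw [prodSet_empty]; exact Set.singleton_nonempty _
  | insert i A hi ih =>
    rw [prodSet_insert E hi]
    exact smul_nonempty (Set.singleton_nonempty _) ih

theorem exists_prodSet_eq (E : EA2Data H) (A : Finset (Fin E.n)) : ∃ x, E.prodSet A = {x} := by
  classical
  obtain ⟨x, hx⟩ := E.prodSet_nonempty A
  have h := E.famProd_eq_prodSet A (r := fun i => if i ∈ A then E.q i else E.hg.e)
    (fun i hi => if_pos hi) (fun i hi => if_neg hi)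
  rw [← h] at hx ⊢
  refine ⟨x, famProd_eq_singleton (fun i => ?_) hx⟩
  rw [mem_gen_q]
  split_ifs <;> simp

/-- The element of `H` whose support is `{q i | i ∈ A}`. -/
noncomputable def point (E : EA2Data H) (A : Finset (Fin E.n)) : H :=
  (E.exists_prodSet_eq A).choose

theorem prodSet_eq (E : EA2Data H) (A : Finset (Fin E.n)) : E.prodSet A = {E.point A} :=
  (E.exists_prodSet_eq A).choose_spec

theorem point_empty (E : EA2Data H) : E.point ∅ = E.hg.e :=
  Set.singleton_injective (by rw [← prodSet_eq, prodSet_empty])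

theorem point_singleton (E : EA2Data H) (i : Fin E.n) : E.point {i} = E.q i := by
  refine Set.singleton_injective ?_
  rw [← prodSet_eq, ← insert_empty_eq, prodSet_insert E (Finset.notMem_empty i), prodSet_empty,
    smul_singleton, E.hg.idr]

open Classical in
theorem famProd_eq_point {E : EA2Data H} {r : Fin E.n → H}
    (hr : ∀ i, r i ∈ E.hg.gen {E.q i}) :
    E.hg.famProd r = {E.point {i | r i = E.q i}} := by
  rw [← prodSet_eq]
  refine famProd_eq_prodSet E _ (fun i hi => by simpa using hi) fun i hi => ?_
  exact (mem_gen_q.1 (hr i)).resolve_right (by simpa using hi)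

theorem point_surjective (E : EA2Data H) : Function.Surjective E.point := by
  intro x
  obtain ⟨r, hr, hx⟩ := E.exists_decomp x
  rw [famProd_eq_point hr] at hx
  exact ⟨_, Set.singleton_injective hx⟩

theorem mem_prod_pair {E : EA2Data H} {S : Finset (Fin E.n)} {z : H} :
    (z ∈ letI := E.setCommMonoid; ∏ i ∈ S, ({E.hg.e, E.q i} : Set H)) ↔
      ∃ D ⊆ S, z = E.point D := by
  let _ := E.setCommMonoid
  induction S using Finset.induction_on generalizing z with
  | empty =>
    rw [Finset.prod_empty]
    change z = E.hg.e ↔ _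
    simp [point_empty]
  | insert i S hi ih =>
    rw [Finset.prod_insert hi]
    have step {D : Finset (Fin E.n)} (hD : D ⊆ S) :
        z = E.point (insert i D) ↔ z ∈ E.hg.hmul (E.q i) (E.point D) := by
      rw [← smul_singleton, ← prodSet_eq, ← prodSet_insert E fun h => hi (hD h), prodSet_eq]
      rfl
    constructor
    · rintro ⟨b, hb, c, hc, hz⟩
      obtain ⟨D, hD, rfl⟩ := ih.1 hc
      rcases hb with rfl | rfl
      · rw [E.hg.idl] at hz
        exact ⟨D, hD.trans (Finset.subset_insert _ _), hz⟩
      · exact ⟨insert i D, Finset.insert_subset_insert _ hD, (step hD).2 hz⟩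
    · rintro ⟨D, hD, hz⟩
      have hD' : D.erase i ⊆ S := by rwa [← Finset.subset_insert_iff]
      refine ⟨if i ∈ D then E.q i else E.hg.e, by split_ifs <;> simp, E.point (D.erase i),
        ih.2 ⟨_, hD', rfl⟩, ?_⟩
      split_ifs with h
      · rwa [← step hD', Finset.insert_erase h]
      · rw [E.hg.idl, Finset.erase_eq_of_notMem h]
        exact hz

open Classical in
theorem prodSet_sq (E : EA2Data H) (A : Finset (Fin E.n)) :
    E.hg.smul (E.prodSet A) (E.prodSet A) =
      letI := E.setCommMonoid; ∏ i ∈ A with E.hg.IsThick (E.q i), ({E.hg.e, E.q i} : Set H) := by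
  let _ := E.setCommMonoid
  rw [Finset.prod_filter]
  refine (Finset.prod_mul_distrib (f := fun i => ({E.q i} : Set H))
    (g := fun i => ({E.q i} : Set H))).symm.trans (Finset.prod_congr rfl fun i _ => ?_)
  change E.hg.smul _ _ = _
  rw [smul_singleton]
  split_ifs with h
  · exact (E.invol i).sq_of_isThick h
  · exact (E.invol i).isThin_iff.1 (not_not.1 h)

open Classical in
theorem mem_hmul_point {E : EA2Data H} {A B : Finset (Fin E.n)} {z : H} :
    z ∈ E.hg.hmul (E.point A) (E.point B) ↔
      ∃ D ⊆ (A ∩ B).filter fun i => E.hg.IsThick (E.q i), z = E.point (symmDiff A B ∪ D) := by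
  let _ := E.setCommMonoid
  have hA : E.prodSet A = E.prodSet (A \ B) * E.prodSet (A ∩ B) :=
    (congrArg E.prodSet (Finset.sdiff_union_inter A B).symm).trans
      (prodSet_union E (Finset.disjoint_sdiff_inter A B))
  have hB : E.prodSet B = E.prodSet (B \ A) * E.prodSet (A ∩ B) := by
    rw [Finset.inter_comm]
    exact (congrArg E.prodSet (Finset.sdiff_union_inter B A).symm).trans
      (prodSet_union E (Finset.disjoint_sdiff_inter B A))
  have hAB : E.prodSet (symmDiff A B) = E.prodSet (A \ B) * E.prodSet (B \ A) :=
    prodSet_union E disjoint_sdiff_sdiff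
  have key : E.prodSet A * E.prodSet B =
      E.prodSet (symmDiff A B) * (E.prodSet (A ∩ B) * E.prodSet (A ∩ B)) := by
    rw [hAB, hA, hB, mul_mul_mul_comm]
  have hsq : E.prodSet (A ∩ B) * E.prodSet (A ∩ B) = _ := E.prodSet_sq (A ∩ B)
  have hmul : E.hg.hmul (E.point A) (E.point B) = E.prodSet A * E.prodSet B := by
    rw [← smul_singleton, ← prodSet_eq, ← prodSet_eq]; rfl
  have step {D : Finset (Fin E.n)} (hD : D ⊆ (A ∩ B).filter fun i => E.hg.IsThick (E.q i)) :
      z = E.point (symmDiff A B ∪ D) ↔ z ∈ E.hg.hmul (E.point (symmDiff A B)) (E.point D) := by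
    have hdisj : Disjoint (symmDiff A B) D :=
      (disjoint_symmDiff_inf A B).mono_right (hD.trans (Finset.filter_subset _ _))
    rw [← smul_singleton, ← prodSet_eq, ← prodSet_eq, ← prodSet_union E hdisj, prodSet_eq]
    rfl
  rw [hmul, key, hsq, prodSet_eq]
  constructor
  · intro h
    obtain ⟨c, hc, hz⟩ := mem_smul_left.1 h
    obtain ⟨D, hD, rfl⟩ := mem_prod_pair.1 hc
    exact ⟨D, hD, (step hD).2 hz⟩
  · rintro ⟨D, hD, hz⟩
    exact mem_smul_left.2 ⟨E.point D, mem_prod_pair.2 ⟨D, hD, rfl⟩, (step hD).1 hz⟩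

theorem star_point (E : EA2Data H) (A : Finset (Fin E.n)) :
    E.hg.star (E.point A) = E.point A := by
  classical
  refine star_eq_of_e_mem (mem_hmul_point.2 ⟨∅, Finset.empty_subset _, ?_⟩)
  simp [point_empty]

theorem point_mem_cofactor {E : EA2Data H} {A : Finset (Fin E.n)} {i : Fin E.n} (hi : i ∉ A) :
    E.point A ∈ E.hg.cofactor (fun i => E.hg.gen {E.q i}) i := by
  let _ := E.setCommMonoid
  rw [cofactor, listProd_eq_prod]
  have h : (((List.finRange E.n).filter fun j => decide (j ≠ i)).map
      fun j => E.hg.gen {E.q j}).prod = ∏ j ∈ Finset.univ.erase i, ({E.hg.e, E.q j} : Set H) := by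
    rw [← List.prod_toFinset _ ((List.nodup_finRange _).filter _)]
    refine Finset.prod_congr (by ext; simp) fun j _ => (E.invol j).gen_eq
  exact h ▸ mem_prod_pair.2
    ⟨A, fun j hj => Finset.mem_erase.2 ⟨ne_of_mem_of_not_mem hj hi, Finset.mem_univ j⟩, rfl⟩

theorem subset_of_point_eq {E : EA2Data H} {A B : Finset (Fin E.n)}
    (h : E.point A = E.point B) : A ⊆ B := by
  classical
  intro i hA
  by_contra hB
  have h1 : E.point A ∈ E.hg.hmul (E.q i) (E.point (A.erase i)) := by
    rw [← smul_singleton, ← prodSet_eq E (A.erase i), ← prodSet_insert E (Finset.notMem_erase i A),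
      Finset.insert_erase hA, prodSet_eq]
    rfl
  rw [E.hg.h3l, star_point, h] at h1
  obtain ⟨D, hD, hq⟩ := mem_hmul_point.1 h1
  have hi : i ∉ symmDiff B (A.erase i) ∪ D := by
    intro hi
    rcases Finset.mem_union.1 hi with hi | hi
    · simp [Finset.mem_symmDiff, hB] at hi
    · exact hB (Finset.mem_inter.1 (Finset.mem_filter.1 (hD hi)).1).1
  have hmem : E.q i ∈ ({E.hg.e} : Set H) := by
    rw [← E.dp.2.2 i]
    refine ⟨mem_gen_q.2 (Or.inr rfl), ?_⟩
    rw [hq]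
    exact point_mem_cofactor hi
  exact (E.invol i).1 hmem

theorem point_injective (E : EA2Data H) : Function.Injective E.point := fun _ _ h =>
  (subset_of_point_eq h).antisymm (subset_of_point_eq h.symm)

theorem q_injective (E : EA2Data H) : Function.Injective E.q := fun i j h => by
  rw [← point_singleton, ← point_singleton] at h
  exact Finset.singleton_injective (E.point_injective h)

theorem support_point (E : EA2Data H) (A : Finset (Fin E.n)) :
    E.support (E.point A) = E.q '' A := by
  classical
  ext y
  constructor
  · rintro ⟨hy, r, ⟨hr, hA⟩, i, rfl⟩
    rw [famProd_eq_point hr] at hA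
    obtain rfl := E.point_injective hA
    have hi := (mem_gen_q.1 (hr i)).resolve_left hy
    exact ⟨i, by simpa using hi, hi.symm⟩
  · rintro ⟨i, hi, rfl⟩
    refine ⟨(E.invol i).1, fun j => if j ∈ A then E.q j else E.hg.e, ⟨fun j => ?_, ?_⟩,
      i, if_pos hi⟩
    · change _ ∈ E.hg.gen {E.q j}
      rw [mem_gen_q]
      by_cases hj : j ∈ A <;> simp [hj]
    · rw [E.famProd_eq_prodSet A (fun j hj => if_pos hj) (fun j hj => if_neg hj), prodSet_eq]
      rfl

open Classical in
theorem sElem_point (E : EA2Data H) (A : Finset (Fin E.n)) :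
    E.sElem (E.point A) = (A.filter fun i => E.hg.IsThick (E.q i)).card := by
  have h : {y ∈ E.support (E.point A) | E.hg.IsThick y} =
      E.q '' (A.filter fun i => E.hg.IsThick (E.q i) : Finset (Fin E.n)) := by
    rw [support_point]
    ext y
    simp only [Set.mem_image, SetLike.mem_coe, Finset.mem_filter]
    grind
  rw [sElem, h, Set.ncard_image_of_injective _ E.q_injective, Set.ncard_coe_finset]

/-- The indices of the thick involutions occurring in the support of an element of `G`. -/
noncomputable def thickIndices (E : EA2Data H) (G : Set H) : Finset (Fin E.n) := by
  classical
  exact {i | E.hg.IsThick (E.q i) ∧ ∃ A, i ∈ A ∧ E.point A ∈ G}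

theorem mem_thickIndices {E : EA2Data H} {G : Set H} {i : Fin E.n} :
    i ∈ E.thickIndices G ↔ E.hg.IsThick (E.q i) ∧ ∃ A, i ∈ A ∧ E.point A ∈ G := by
  simp [thickIndices]

theorem hmul_subset_of_isClosed {E : EA2Data H} {G : Set H} (hG : E.hg.IsClosed G) {x y : H}
    (hx : x ∈ G) (hy : y ∈ G) : E.hg.hmul x y ⊆ G := by
  intro z hz
  obtain ⟨A, rfl⟩ := E.point_surjective x
  exact hG.2 ⟨_, ⟨_, hx, star_point E A⟩, y, hy, hz⟩

theorem point_mem_of_forall_q_mem {E : EA2Data H} {G : Set H} (hG : E.hg.IsClosed G)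
    {S : Finset (Fin E.n)} (hS : ∀ i ∈ S, E.q i ∈ G) : E.point S ∈ G := by
  induction S using Finset.induction_on with
  | empty => rw [point_empty]; exact hG.e_mem
  | insert i S hi ih =>
    refine hmul_subset_of_isClosed hG (hS i (Finset.mem_insert_self i S))
      (ih fun j hj => hS j (Finset.mem_insert_of_mem hj)) ?_
    rw [← smul_singleton, ← prodSet_eq, ← prodSet_insert E hi, prodSet_eq]
    rfl

theorem q_mem_hmul_point_self {E : EA2Data H} {A : Finset (Fin E.n)} {i : Fin E.n} (hi : i ∈ A)
    (ht : E.hg.IsThick (E.q i)) : E.q i ∈ E.hg.hmul (E.point A) (E.point A) := by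
  classical
  refine mem_hmul_point.2 ⟨{i}, ?_, ?_⟩
  · simpa using ⟨hi, ht⟩
  · rw [symmDiff_self, Finset.bot_eq_empty, Finset.empty_union, point_singleton]

theorem point_mem_of_subset_thickIndices {E : EA2Data H} {G : Set H} (hG : E.hg.IsClosed G)
    {S : Finset (Fin E.n)} (hS : S ⊆ E.thickIndices G) : E.point S ∈ G := by
  refine point_mem_of_forall_q_mem hG fun i hi => ?_
  obtain ⟨ht, A, hiA, hA⟩ := mem_thickIndices.1 (hS hi)
  exact hmul_subset_of_isClosed hG hA hA (q_mem_hmul_point_self hiA ht)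

theorem thickIn_eq_image {E : EA2Data H} {G : Set H} (hG : E.hg.IsClosed G) :
    E.ThickIn G = E.point '' (E.thickIndices G).powerset := by
  ext x
  obtain ⟨A, rfl⟩ := E.point_surjective x
  rw [E.point_injective.mem_set_image, SetLike.mem_coe, Finset.mem_powerset]
  constructor
  · rintro ⟨hA, h | h⟩ i hi
    · rw [← point_empty] at h
      rw [E.point_injective h] at hi
      simp at hi
    · rw [support_point] at h
      exact mem_thickIndices.2 ⟨h _ ⟨i, hi, rfl⟩, A, hi, hA⟩
  · refine fun h => ⟨point_mem_of_subset_thickIndices hG h, Or.inr ?_⟩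
    rw [support_point]
    rintro _ ⟨i, hi, rfl⟩
    exact (mem_thickIndices.1 (h hi)).1

theorem isStronglyNormal_thickIn {E : EA2Data H} {G : Set H} (hG : E.hg.IsClosed G) :
    E.hg.IsStronglyNormal (E.ThickIn G) G := by
  classical
  refine ⟨⟨⟨E.hg.e, hG.e_mem, Or.inl rfl⟩, ?_⟩, hG, fun x hx => hx.1, ?_⟩
  · rw [thickIn_eq_image hG]
    rintro x ⟨_, ⟨_, ⟨A, hA, rfl⟩, rfl⟩, _, ⟨B, hB, rfl⟩, hx⟩
    rw [star_point] at hx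
    obtain ⟨D, hD, rfl⟩ := mem_hmul_point.1 hx
    refine ⟨_, ?_, rfl⟩
    simp only [SetLike.mem_coe, Finset.mem_powerset] at hA hB ⊢
    intro i hi
    have := @hA i
    have := @hB i
    have := @hD i
    simp only [Finset.mem_union, Finset.mem_symmDiff, Finset.mem_filter, Finset.mem_inter] at *
    tauto
  · rintro p hp x ⟨y, ⟨_, rfl, f, hf, hy⟩, p, rfl, hx⟩
    obtain ⟨A, rfl⟩ := E.point_surjective p
    have hxG : x ∈ G := by
      rw [star_point] at hy
      exact hmul_subset_of_isClosed hG (hmul_subset_of_isClosed hG hp hf.1 hy) hp hx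
    rw [thickIn_eq_image hG] at hf ⊢
    obtain ⟨B, hB, rfl⟩ := hf
    rw [star_point] at hy
    obtain ⟨D, hD, rfl⟩ := mem_hmul_point.1 hy
    obtain ⟨D', hD', rfl⟩ := mem_hmul_point.1 hx
    refine ⟨_, ?_, rfl⟩
    simp only [SetLike.mem_coe, Finset.mem_powerset] at hB ⊢
    intro i hi
    refine mem_thickIndices.2 ⟨?_, _, hi, hxG⟩
    have := @hB i
    have := @hD i
    have := @hD' i
    simp only [Finset.mem_union, Finset.mem_symmDiff, Finset.mem_filter, Finset.mem_inter,
      mem_thickIndices] at *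
    tauto

theorem thickIn_eq_Osup {E : EA2Data H} {G : Set H} (hG : E.hg.IsClosed G) :
    E.ThickIn G = E.hg.Osup G := by
  rw [Osup, hG.gen_eq]
  refine Set.Subset.antisymm (Set.subset_sInter fun F hF => ?_)
    (Set.sInter_subset_of_mem (isStronglyNormal_thickIn hG))
  rw [thickIn_eq_image hG]
  rintro _ ⟨S, hS, rfl⟩
  refine point_mem_of_forall_q_mem hF.1 fun i hi => ?_
  obtain ⟨ht, A, hiA, hA⟩ := mem_thickIndices.1 (Finset.mem_powerset.1 hS hi)
  refine hF.2.2.2 _ hA ⟨E.point A, ⟨_, rfl, E.hg.e, hF.1.e_mem, ?_⟩, _, rfl,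
    q_mem_hmul_point_self hiA ht⟩
  simp [E.hg.idr, star_point]

theorem sSet_eq_card {E : EA2Data H} {G : Set H} (hG : E.hg.IsClosed G) :
    E.sSet G = (E.thickIndices G).card := by
  classical
  refine IsGreatest.csSup_eq
    ⟨⟨_, point_mem_of_subset_thickIndices hG subset_rfl, ?_⟩, ?_⟩
  · rw [sElem_point, Finset.filter_true_of_mem fun i hi => (mem_thickIndices.1 hi).1]
  · rintro _ ⟨x, hx, rfl⟩
    obtain ⟨A, rfl⟩ := E.point_surjective x
    rw [sElem_point]
    refine Finset.card_le_card fun i hi => ?_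
    rw [Finset.mem_filter] at hi
    exact mem_thickIndices.2 ⟨hi.2, A, hi.1, hx⟩

theorem ncard_thickIn {E : EA2Data H} {G : Set H} (hG : E.hg.IsClosed G) :
    (E.ThickIn G).ncard = 2 ^ E.sSet G := by
  rw [thickIn_eq_image hG, Set.ncard_image_of_injective _ E.point_injective,
    Set.ncard_coe_finset, Finset.card_powerset, sSet_eq_card hG]

end EA2Data

end HyperPaper

open HyperPaper

/-- For a closed subset G of an elementary abelian 2-hypergroup:
Thick(G) = O^ϑ(G) and |Thick(G)| = |O^ϑ(G)| = 2^{s(G)}. -/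
theorem stmt5 {H : Type*} (E : EA2Data H) (G : Set H) (hG : E.hg.IsClosed G) :
    E.ThickIn G = E.hg.Osup G ∧ (E.ThickIn G).ncard = (E.hg.Osup G).ncard ∧
      (E.hg.Osup G).ncard = 2 ^ E.sSet G := by
  have h := EA2Data.thickIn_eq_Osup hG
  exact ⟨h, by rw [h], by rw [← h, EA2Data.ncard_thickIn hG]⟩
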